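/- There exist a computable map f : [0,1] → [0,1] and a closed f-invariant set A ⊆ [0,1] such that A is a metric attractor of f with respect to Lebesgue measure, the inner collection {(a,b) ∈ ℚ × ℚ : a < b, (a,b) ∩ A ≠ ∅} is Π₂, and Tot many-one reduces to it. -/

import Mathlib

open Filter Topology MeasureTheory Set
open scoped ENNReal NNReal

/-- Cylinder of a finite word in Cantor space: the set of sequences beginning with `w`. -/
def cyl {𝒜 : Type*} (w : List 𝒜) : Set (ℕ → 𝒜) :=
  {x | ∀ i : Fin w.length, x i = w.get i}

/-- The shift map on Cantor space. -/
def shiftMap {𝒜 : Type*} (x : ℕ → 𝒜) : ℕ → 𝒜 := fun i => x (i + 1)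

/-- ω-limit set of `x` under iteration of `T`: the set of accumulation points of the orbit. -/
def omegaSet {X : Type*} [TopologicalSpace X] (T : X → X) (x : X) : Set X :=
  {y | MapClusterPt y Filter.atTop fun n => T^[n] x}

/-- Realm of attraction `ρ(A) = {x : ω(x) ⊆ A}`. -/
def realm {X : Type*} [TopologicalSpace X] (T : X → X) (A : Set X) : Set X :=
  {x | omegaSet T x ⊆ A}

/-- `A` is a topological attractor of `T`: a closed invariant set whose realm of attraction is
residual, and such that no strictly smaller closed subset has nonmeager realm of attraction. -/
def IsTopAttractor {X : Type*} [TopologicalSpace X] (T : X → X) (A : Set X) : Prop :=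
  IsClosed A ∧ Set.MapsTo T A A ∧ realm T A ∈ residual X ∧
    ∀ A' : Set X, IsClosed A' → A' ⊂ A → IsMeagre (realm T A')

/-- `A` is a metric attractor of `T` w.r.t. `lam`: a closed invariant set whose realm of
attraction has full measure, and no strictly smaller closed subset has realm of positive
measure. -/
def IsMetricAttractor {X : Type*} [TopologicalSpace X] [MeasurableSpace X]
    (T : X → X) (lam : Measure X) (A : Set X) : Prop :=
  IsClosed A ∧ Set.MapsTo T A A ∧ lam (realm T A) = 1 ∧
    ∀ A' : Set X, IsClosed A' → A' ⊂ A → lam (realm T A') = 0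

/-- Empirical (Birkhoff) measures `ν_n(x) = (1/n) ∑_{i<n} δ_{T^i x}`. -/
noncomputable def empMeasure {X : Type*} [MeasurableSpace X] (T : X → X) (x : X) (n : ℕ) :
    Measure X :=
  (n : ℝ≥0∞)⁻¹ • ∑ i ∈ Finset.range n, Measure.dirac (T^[i] x)

/-- Weak-* convergence of a sequence of measures: integrals of continuous functions converge. -/
def WeakTendsto {X : Type*} [TopologicalSpace X] [MeasurableSpace X]
    (μs : ℕ → Measure X) (μ : Measure X) : Prop :=
  ∀ φ : C(X, ℝ), Filter.Tendsto (fun n => ∫ x, φ x ∂(μs n)) Filter.atTop (nhds (∫ x, φ x ∂μ))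

/-- Topological support of a measure: points all of whose open neighbourhoods have positive
measure. -/
def measSupport {X : Type*} [TopologicalSpace X] [MeasurableSpace X]
    (μ : Measure X) : Set X :=
  {x | ∀ U : Set X, IsOpen U → x ∈ U → 0 < μ U}

/-- `A` is a statistical (physical) attractor of `T` w.r.t. `lam`: there is a `T`-invariant
probability measure `μ` with support `A` such that for `lam`-a.e. `x` the empirical measures
converge weak-* to `μ`. -/
def IsStatAttractor {X : Type*} [TopologicalSpace X] [MeasurableSpace X]
    (T : X → X) (lam : Measure X) (A : Set X) : Prop :=
  IsClosed A ∧ ∃ μ : Measure X, IsProbabilityMeasure μ ∧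
    Measure.map T μ = μ ∧ measSupport μ = A ∧
    ∀ᵐ x ∂lam, WeakTendsto (empMeasure T x) μ

/-- `A` is strongly attracting: there is an open `U ⊇ A` with `T (closure U) ⊆ U` and
`A = ⋂ₙ Tⁿ(U)`. -/
def StronglyAttracting {X : Type*} [TopologicalSpace X] (T : X → X) (A : Set X) : Prop :=
  ∃ U : Set X, IsOpen U ∧ A ⊆ U ∧ T '' (closure U) ⊆ U ∧ A = ⋂ n : ℕ, T^[n] '' U

/-- `S` is Σ₁ (recursively enumerable). -/
def SigmaOne {I : Type*} [Primcodable I] (S : Set I) : Prop :=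
  ∃ f : I × ℕ → Bool, Computable f ∧ ∀ i, i ∈ S ↔ ∃ a, f (i, a) = true

/-- `S` is Π₁ (co-r.e.). -/
def PiOne {I : Type*} [Primcodable I] (S : Set I) : Prop := SigmaOne Sᶜ

/-- `S` is Σ₂. -/
def SigmaTwo {I : Type*} [Primcodable I] (S : Set I) : Prop :=
  ∃ f : I × ℕ × ℕ → Bool, Computable f ∧ ∀ i, i ∈ S ↔ ∃ a, ∀ b, f (i, a, b) = true

/-- `S` is Π₂. -/
def PiTwo {I : Type*} [Primcodable I] (S : Set I) : Prop :=
  ∃ f : I × ℕ × ℕ → Bool, Computable f ∧ ∀ i, i ∈ S ↔ ∀ a, ∃ b, f (i, a, b) = true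

/-- A map of Cantor space is computable if `(T x) n` is computed by a computable function from
`n` and the finite prefix `[x 0, …, x (α n)]` of `x`, for a computable modulus `α`. -/
def CantorComputable {𝒜 : Type} [Primcodable 𝒜] (T : (ℕ → 𝒜) → (ℕ → 𝒜)) : Prop :=
  ∃ (α : ℕ → ℕ) (β : ℕ → List 𝒜 → 𝒜), Computable α ∧ Computable₂ β ∧
    ∀ (x : ℕ → 𝒜) (n : ℕ), T x n = β n (List.ofFn fun i : Fin (α n + 1) => x i)

/-- A Borel probability measure on Cantor space is computable if the measures of finite unions
of cylinders are uniformly lower-computable: `lam(⋃_{w ∈ W} [w]) = sup_k q (W, k)` for a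
computable `q`. -/
def ComputableCantorMeasure {𝒜 : Type} [Primcodable 𝒜] [MeasurableSpace 𝒜]
    (lam : Measure (ℕ → 𝒜)) : Prop :=
  ∃ q : List (List 𝒜) × ℕ → ℚ, Computable q ∧
    ∀ W : List (List 𝒜), (lam (⋃ w ∈ W, cyl w)).toReal = ⨆ k, (q (W, k) : ℝ)

/-- Indices of machines halting on input 0. -/
def HaltSet : Set ℕ := {e | ((Denumerable.ofNat Nat.Partrec.Code e).eval 0).Dom}

/-- Indices of total machines. -/
def TotSet : Set ℕ := {e | ∀ n, ((Denumerable.ofNat Nat.Partrec.Code e).eval n).Dom}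

/-- Indices of machines with finite domain. -/
def FinSet : Set ℕ := {e | {n | ((Denumerable.ofNat Nat.Partrec.Code e).eval n).Dom}.Finite}

/-- A map `f : [0,1] → [0,1]` is computable: there are computable `m : ℕ → ℕ` and
`ψ : ℚ × ℕ → ℚ` such that whenever `x ∈ [0,1]` and `|x - q| ≤ 2^{-m n}`,
`|f x - ψ (q, n)| ≤ 2^{-n}`. -/
def ComputableRealMap (f : ℝ → ℝ) : Prop :=
  ∃ (m : ℕ → ℕ) (ψ : ℚ × ℕ → ℚ), Computable m ∧ Computable ψ ∧
    ∀ x ∈ Set.Icc (0:ℝ) 1, ∀ (q : ℚ) (n : ℕ),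
      |x - (q : ℝ)| ≤ 1 / 2 ^ (m n) → |f x - (ψ (q, n) : ℝ)| ≤ 1 / 2 ^ n

/-- A map `φ` from Cantor space to ℝ is computable: a rational `2^{-n}`-approximation of `φ x`
is computed from `n` and the finite prefix `[x 0, …, x (k n)]` of `x`. -/
def ComputableCantorRealMap (φ : (ℕ → Bool) → ℝ) : Prop :=
  ∃ (k : ℕ → ℕ) (Φ : ℕ × List Bool → ℚ), Computable k ∧ Computable Φ ∧
    ∀ (x : ℕ → Bool) (n : ℕ),
      |φ x - (Φ (n, List.ofFn fun i : Fin (k n + 1) => x i) : ℝ)| ≤ 1 / 2 ^ n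

/-- A closed `K ⊆ [0,1]` is a computable closed set: both the rational open intervals meeting
`K` and the rational closed intervals missing `K` are Σ₁. -/
def ComputableClosedReal (K : Set ℝ) : Prop :=
  SigmaOne {p : ℚ × ℚ | p.1 < p.2 ∧ (Set.Ioo (p.1 : ℝ) (p.2 : ℝ) ∩ K).Nonempty} ∧
  SigmaOne {p : ℚ × ℚ | p.1 < p.2 ∧ Set.Icc (p.1 : ℝ) (p.2 : ℝ) ∩ K = ∅}

/-- A Borel probability measure on `[0,1] ⊆ ℝ` is computable if the measures of finite unions
of rational open intervals are uniformly lower-computable. -/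
def ComputableIntervalMeasure (μ : MeasureTheory.Measure ℝ) : Prop :=
  ∃ q : List (ℚ × ℚ) × ℕ → ℚ, Computable q ∧
    ∀ W : List (ℚ × ℚ),
      (μ (⋃ p ∈ W, Set.Ioo (p.1 : ℝ) (p.2 : ℝ))).toReal = ⨆ k, (q (W, k) : ℝ)

namespace RatComputability

open Encodable Denumerable

/-- Codes of rationals under the injective (non surjective) encoding `Rat.instEncodable`. -/
def IsRatCode (k : ℕ) : Prop :=
  0 < k.unpair.2 ∧ ∀ x < k.unpair.2 + 1, x ∣ (k.unpair.1 + 1) / 2 → x ∣ k.unpair.2 → x ≤ 1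

lemma natAbs_eq_intEquivNat (i : ℤ) : i.natAbs = (Equiv.intEquivNat i + 1) / 2 := by
  cases i with
  | ofNat n => change n = (2 * n + 1) / 2; omega
  | negSucc n => change n + 1 = (2 * n + 1 + 1) / 2; omega

lemma intEquivNat_eq (i : ℤ) : i = if Equiv.intEquivNat i % 2 = 0 then
    ((Equiv.intEquivNat i / 2 : ℕ) : ℤ) else -(((Equiv.intEquivNat i + 1) / 2 : ℕ) : ℤ) := by
  cases i with
  | ofNat n =>
    change (n : ℤ) = if (2 * n) % 2 = 0 then ((2 * n / 2 : ℕ) : ℤ) else _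
    rw [if_pos (by omega)]; congr 1; omega
  | negSucc n =>
    change Int.negSucc n = if (2 * n + 1) % 2 = 0 then _ else -(((2 * n + 1 + 1) / 2 : ℕ) : ℤ)
    rw [if_neg (by omega), Int.negSucc_eq]; omega

lemma isRatCode_iff (k : ℕ) : IsRatCode k ↔
    k ∈ Set.range (@encode ℚ Rat.instEncodable) := by
  constructor
  · rintro ⟨hd, h⟩
    set i := Equiv.intEquivNat.symm k.unpair.1 with hi
    have hi' : Equiv.intEquivNat i = k.unpair.1 := by simp [hi]
    have hc : i.natAbs.Coprime k.unpair.2 := by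
      rw [natAbs_eq_intEquivNat, hi']
      have hg := Nat.gcd_pos_of_pos_right ((k.unpair.1 + 1) / 2) hd
      have := h (Nat.gcd ((k.unpair.1 + 1) / 2) k.unpair.2)
        (Nat.lt_succ_of_le (Nat.le_of_dvd hd (Nat.gcd_dvd_right _ _)))
        (Nat.gcd_dvd_left _ _) (Nat.gcd_dvd_right _ _)
      exact le_antisymm this hg
    refine ⟨⟨i, k.unpair.2, hd.ne', hc⟩, ?_⟩
    change Nat.pair (Equiv.intEquivNat i) k.unpair.2 = k
    rw [hi', Nat.pair_unpair]
  · rintro ⟨q, rfl⟩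
    change IsRatCode (Nat.pair (Equiv.intEquivNat q.num) q.den)
    unfold IsRatCode
    rw [Nat.unpair_pair]
    refine ⟨q.pos, fun x _ h1 h2 => ?_⟩
    rw [← natAbs_eq_intEquivNat] at h1
    exact (Nat.dvd_one.1 (q.reduced ▸ Nat.dvd_gcd h1 h2)).le

lemma isRatCode_computable : ComputablePred IsRatCode := by
  apply PrimrecPred.computablePred
  have hd : Primrec fun k : ℕ => k.unpair.2 := Primrec.snd.comp Primrec.unpair
  have hn : Primrec fun k : ℕ => (k.unpair.1 + 1) / 2 :=
    Primrec.nat_div.comp (Primrec.succ.comp (Primrec.fst.comp Primrec.unpair)) (Primrec.const 2)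
  have hdvd : PrimrecRel fun x y : ℕ => x ∣ y :=
    (Primrec.eq.comp (Primrec.nat_mod.comp Primrec.snd Primrec.fst) (Primrec.const 0)).of_eq
      fun p => (Nat.dvd_iff_mod_eq_zero).symm
  have hR : PrimrecRel fun (x k : ℕ) => ¬ (x ∣ (k.unpair.1 + 1) / 2) ∨ ¬ (x ∣ k.unpair.2) ∨ x ≤ 1 :=
    ((hdvd.comp Primrec.fst (hn.comp Primrec.snd)).not).or
      (((hdvd.comp Primrec.fst (hd.comp Primrec.snd)).not).or
        (Primrec.nat_le.comp Primrec.fst (Primrec.const 1)))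
  have := (Primrec.nat_lt.comp (Primrec.const 0) hd).and
    (hR.forall_lt.comp (Primrec.succ.comp hd) Primrec.id)
  refine this.of_eq fun k => ?_
  simp only [IsRatCode, id, Nat.succ_eq_add_one]
  refine and_congr_right fun _ => forall₂_congr fun x _ => ?_
  tauto

lemma exists_isRatCode_gt (k : ℕ) : ∃ m, k < m ∧ IsRatCode m := by
  have hinf : (Set.range (@encode ℚ Rat.instEncodable)).Infinite :=
    Set.infinite_range_of_injective (@encode_injective ℚ Rat.instEncodable)
  obtain ⟨m, hm, hk⟩ := hinf.exists_gt k
  exact ⟨m, hk, (isRatCode_iff m).2 hm⟩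

/-- The code `Rat.instEncodable` assigns to the `n`-th rational is a computable function of `n`. -/
lemma computable_encode_ofNat :
    Computable fun n : ℕ => @encode ℚ Rat.instEncodable (ofNat ℚ n) := by
  classical
  have hstep : Computable fun k : ℕ => Nat.find (exists_isRatCode_gt k) := by
    apply Computable.find (P := fun k m => k < m ∧ IsRatCode m)
    obtain ⟨_, h⟩ := isRatCode_computable
    refine ⟨fun _ => inferInstance, ?_⟩
    refine (Primrec.and.to_comp.comp (Primrec.nat_lt.decide.to_comp.comp Computable.fst
      Computable.snd) (h.comp Computable.snd)).of_eq fun p => ?_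
    simp only [Bool.decide_and]
  have hrec : Computable fun n : ℕ =>
      (Nat.rec (@encode ℚ Rat.instEncodable (ofNat ℚ 0))
        (fun _ k => Nat.find (exists_isRatCode_gt k)) n : ℕ) :=
    Computable.nat_rec Computable.id (Computable.const _)
      (hstep.comp (Computable.snd.comp Computable.snd)).to₂
  refine hrec.of_eq fun n => ?_
  induction n with
  | zero => rfl
  | succ n ih =>
    simp only at ih ⊢
    rw [ih]
    let s := Set.range (@encode ℚ Rat.instEncodable)
    let : DecidablePred (· ∈ s) := decidableRangeEncode ℚ
    have : Infinite s := Infinite.of_injective _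
      (Equiv.ofInjective _ (@encode_injective ℚ Rat.instEncodable)).injective
    have key : ∀ m, @encode ℚ Rat.instEncodable (ofNat ℚ m) = (Nat.Subtype.ofNat s m : ℕ) := by
      intro m
      have h1 : ofNat ℚ m = (equivRangeEncode ℚ).symm (Nat.Subtype.ofNat s m) := rfl
      have h2 := Equiv.apply_symm_apply (equivRangeEncode ℚ) (Nat.Subtype.ofNat s m)
      rw [← h1] at h2
      exact congrArg Subtype.val h2
    rw [Nat.find_eq_iff]
    refine ⟨⟨?_, ?_⟩, ?_⟩
    · rw [key, key]; exact Nat.Subtype.lt_succ_self (Nat.Subtype.ofNat s n)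
    · rw [isRatCode_iff]; exact ⟨_, rfl⟩
    · rintro m hm ⟨h1, h2⟩
      rw [key] at hm h1
      rw [isRatCode_iff] at h2
      have : Nat.Subtype.ofNat s (n + 1) ≤ ⟨m, h2⟩ :=
        Nat.Subtype.succ_le_of_lt (show Nat.Subtype.ofNat s n < ⟨m, h2⟩ from h1)
      exact absurd (show ((Nat.Subtype.ofNat s (n + 1) : s) : ℕ) ≤ m from this) (not_le.2 hm)

/-- Rationals can be computably written as `(p - r) / d` with natural `p`, `r` and `d > 0`. -/
lemma exists_computable_repr : ∃ p r d : ℚ → ℕ, Computable p ∧ Computable r ∧ Computable d ∧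
    ∀ q : ℚ, 0 < d q ∧ q = ((p q : ℚ) - r q) / d q := by
  have hc : Computable fun q : ℚ => @encode ℚ Rat.instEncodable q :=
    (computable_encode_ofNat.comp Computable.encode).of_eq fun q => by rw [ofNat_encode]
  have hi : Computable fun q : ℚ => (@encode ℚ Rat.instEncodable q).unpair.1 :=
    Computable.fst.comp (Computable.unpair.comp hc)
  have hd : Computable fun q : ℚ => (@encode ℚ Rat.instEncodable q).unpair.2 :=
    Computable.snd.comp (Computable.unpair.comp hc)
  have hp : Primrec fun i : ℕ => if i % 2 = 0 then i / 2 else 0 :=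
    Primrec.ite (Primrec.eq.comp (Primrec.nat_mod.comp Primrec.id (Primrec.const 2))
      (Primrec.const 0)) (Primrec.nat_div.comp Primrec.id (Primrec.const 2)) (Primrec.const 0)
  have hr : Primrec fun i : ℕ => if i % 2 = 0 then 0 else (i + 1) / 2 :=
    Primrec.ite (Primrec.eq.comp (Primrec.nat_mod.comp Primrec.id (Primrec.const 2))
      (Primrec.const 0)) (Primrec.const 0)
      (Primrec.nat_div.comp Primrec.succ (Primrec.const 2))
  refine ⟨_, _, _, hp.to_comp.comp hi, hr.to_comp.comp hi, hd, fun q => ?_⟩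
  have he : @encode ℚ Rat.instEncodable q = Nat.pair (Equiv.intEquivNat q.num) q.den := rfl
  rw [he, Nat.unpair_pair]
  refine ⟨q.pos, ?_⟩
  conv_lhs => rw [← Rat.num_div_den q]
  congr 1
  have h0 := intEquivNat_eq q.num
  dsimp only
  generalize Equiv.intEquivNat q.num = m at h0 ⊢
  split_ifs at h0 ⊢ with h1 <;> rw [h0] <;>
    simp only [Int.cast_neg, Int.cast_natCast, Nat.cast_zero, sub_zero, zero_sub]

/-- `(a, b, c) ↦ (a - b) / (c + 1)` is computable. -/
lemma computable_mk : Computable fun x : ℕ × ℕ × ℕ => ((x.1 : ℚ) - x.2.1) / (x.2.2 + 1) := by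
  obtain ⟨p, r, d, hp, hr, hd, h⟩ := exists_computable_repr
  obtain ⟨e, he, hsurj⟩ : ∃ e : ℕ → ℚ, Computable e ∧ Function.Surjective e :=
    ⟨_, Computable.ofNat ℚ, fun q => ⟨_, ofNat_encode q⟩⟩
  let P : ℕ × ℕ × ℕ → ℕ → Prop := fun x n =>
    p (e n) * (x.2.2 + 1) + x.2.1 * d (e n) =
      x.1 * d (e n) + r (e n) * (x.2.2 + 1)
  have hspec : ∀ x n, P x n ↔ e n = ((x.1 : ℚ) - x.2.1) / (x.2.2 + 1) := by
    intro x n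
    obtain ⟨h0, h1⟩ := h (e n)
    have h0' : (0 : ℚ) < d (e n) := by exact_mod_cast h0
    have h2 : (0 : ℚ) < x.2.2 + 1 := by positivity
    conv_rhs => rw [h1]
    rw [div_eq_div_iff h0'.ne' h2.ne']
    simp only [P]
    rw [← Nat.cast_inj (R := ℚ)]
    push_cast
    constructor <;> intro h <;> linarith
  have hex : ∀ x, ∃ n, P x n := fun x =>
    (hsurj (((x.1 : ℚ) - x.2.1) / (x.2.2 + 1))).imp fun n => (hspec x n).2
  have hq : Computable fun y : (ℕ × ℕ × ℕ) × ℕ => e y.2 :=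
    he.comp Computable.snd
  have hx := Computable.fst (α := ℕ × ℕ × ℕ) (β := ℕ)
  have ha := Computable.fst.comp hx
  have hb := Computable.fst.comp (Computable.snd.comp hx)
  have hc := Computable.succ.comp (Computable.snd.comp (Computable.snd.comp hx))
  have hP : ComputablePred fun y : (ℕ × ℕ × ℕ) × ℕ => P y.1 y.2 := by
    refine ⟨fun _ => inferInstanceAs (Decidable (_ = _)), ?_⟩
    refine (Primrec.eq.decide.to_comp.comp
      (Primrec.nat_add.to_comp.comp (Primrec.nat_mul.to_comp.comp (hp.comp hq) hc)
        (Primrec.nat_mul.to_comp.comp hb (hd.comp hq)))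
      (Primrec.nat_add.to_comp.comp (Primrec.nat_mul.to_comp.comp ha (hd.comp hq))
        (Primrec.nat_mul.to_comp.comp (hr.comp hq) hc))).of_eq fun y => ?_
    simp only [P, Nat.succ_eq_add_one]
  let : DecidableRel P := fun _ _ => inferInstanceAs (Decidable (_ = _))
  refine (he.comp (Computable.find hP hex)).of_eq fun x => ?_
  exact (hspec _ _).1 (Nat.find_spec (hex x))

variable {α : Type*} [Primcodable α] {f g : α → ℚ}

lemma computable_div_nat {a b c : α → ℕ} (ha : Computable a) (hb : Computable b)
    (hc : Computable c) (h0 : ∀ x, 0 < c x) :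
    Computable fun x => ((a x : ℚ) - b x) / c x := by
  refine (computable_mk.comp (ha.pair (hb.pair (Computable.pred.comp hc)))).of_eq fun x => ?_
  have h : ((Nat.pred (c x) : ℕ) : ℚ) + 1 = c x := by
    exact_mod_cast Nat.succ_pred_eq_of_pos (h0 x)
  simp only [h]

lemma computable_add (hf : Computable f) (hg : Computable g) :
    Computable fun x => f x + g x := by
  obtain ⟨p, r, d, hp, hr, hd, h⟩ := exists_computable_repr
  have mul := Primrec.nat_mul.to_comp
  have add := Primrec.nat_add.to_comp
  refine (computable_div_nat
    (add.comp (mul.comp (hp.comp hf) (hd.comp hg)) (mul.comp (hp.comp hg) (hd.comp hf)))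
    (add.comp (mul.comp (hr.comp hf) (hd.comp hg)) (mul.comp (hr.comp hg) (hd.comp hf)))
    (mul.comp (hd.comp hf) (hd.comp hg)) fun _ => Nat.mul_pos (h _).1 (h _).1).of_eq fun x => ?_
  have h1 : (d (f x) : ℚ) ≠ 0 := by exact_mod_cast (h (f x)).1.ne'
  have h2 : (d (g x) : ℚ) ≠ 0 := by exact_mod_cast (h (g x)).1.ne'
  conv_rhs => rw [(h (f x)).2, (h (g x)).2]
  push_cast
  field_simp
  ring

lemma computable_neg (hf : Computable f) : Computable fun x => -f x := by
  obtain ⟨p, r, d, hp, hr, hd, h⟩ := exists_computable_repr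
  refine (computable_div_nat (hr.comp hf) (hp.comp hf) (hd.comp hf) fun x => (h _).1).of_eq
    fun x => ?_
  conv_rhs => rw [(h (f x)).2]
  ring

lemma computable_sub (hf : Computable f) (hg : Computable g) : Computable fun x => f x - g x :=
  (computable_add hf (computable_neg hg)).of_eq fun _ => (sub_eq_add_neg _ _).symm

lemma computable_mul (hf : Computable f) (hg : Computable g) :
    Computable fun x => f x * g x := by
  obtain ⟨p, r, d, hp, hr, hd, h⟩ := exists_computable_repr
  have mul := Primrec.nat_mul.to_comp
  have add := Primrec.nat_add.to_comp
  refine (computable_div_nat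
    (add.comp (mul.comp (hp.comp hf) (hp.comp hg)) (mul.comp (hr.comp hf) (hr.comp hg)))
    (add.comp (mul.comp (hp.comp hf) (hr.comp hg)) (mul.comp (hr.comp hf) (hp.comp hg)))
    (mul.comp (hd.comp hf) (hd.comp hg)) fun _ => Nat.mul_pos (h _).1 (h _).1).of_eq fun x => ?_
  have h1 : (d (f x) : ℚ) ≠ 0 := by exact_mod_cast (h (f x)).1.ne'
  have h2 : (d (g x) : ℚ) ≠ 0 := by exact_mod_cast (h (g x)).1.ne'
  conv_rhs => rw [(h (f x)).2, (h (g x)).2]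
  push_cast
  field_simp
  ring

lemma computable_natCast {a : α → ℕ} (ha : Computable a) : Computable fun x => (a x : ℚ) :=
  (computable_div_nat ha (Computable.const 0) (Computable.const 1) fun _ => one_pos).of_eq
    fun _ => by simp

lemma computable_inv_pow (b : ℕ) (hb : 0 < b) {a : α → ℕ} (ha : Computable a) :
    Computable fun x => ((1 : ℚ) / (b : ℚ) ^ a x) := by
  have hpow : Primrec₂ ((· ^ ·) : ℕ → ℕ → ℕ) := Primrec₂.unpaired'.1 Nat.Primrec.pow
  refine (computable_div_nat (Computable.const 1) (Computable.const 0)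
    (hpow.to_comp.comp (Computable.const b) ha) fun _ => pow_pos hb _).of_eq fun _ => by simp

lemma computable_decide_le (hf : Computable f) (hg : Computable g) :
    Computable fun x => decide (f x ≤ g x) := by
  obtain ⟨p, r, d, hp, hr, hd, h⟩ := exists_computable_repr
  have mul := Primrec.nat_mul.to_comp
  have add := Primrec.nat_add.to_comp
  refine (Primrec.nat_le.decide.to_comp.comp
    (add.comp (mul.comp (hp.comp hf) (hd.comp hg)) (mul.comp (hr.comp hg) (hd.comp hf)))
    (add.comp (mul.comp (hp.comp hg) (hd.comp hf)) (mul.comp (hr.comp hf) (hd.comp hg)))).of_eq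
    fun x => ?_
  have h1 : (0 : ℚ) < d (f x) := by exact_mod_cast (h (f x)).1
  have h2 : (0 : ℚ) < d (g x) := by exact_mod_cast (h (g x)).1
  rw [decide_eq_decide, (h (f x)).2, (h (g x)).2, div_le_div_iff₀ h1 h2,
    ← (h (f x)).2, ← (h (g x)).2, ← Nat.cast_le (α := ℚ)]
  push_cast
  constructor <;> intro h <;> linarith

lemma computable_max (hf : Computable f) (hg : Computable g) :
    Computable fun x => max (f x) (g x) := by
  refine (Computable.cond (computable_decide_le hf hg) hg hf).of_eq fun x => ?_
  by_cases h : f x ≤ g x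
  · simp [h]
  · simp [h, (not_le.1 h).le]

lemma computable_min (hf : Computable f) (hg : Computable g) :
    Computable fun x => min (f x) (g x) := by
  refine (Computable.cond (computable_decide_le hf hg) hf hg).of_eq fun x => ?_
  by_cases h : f x ≤ g x
  · simp [h]
  · simp [h, (not_le.1 h).le]

lemma computable_abs (hf : Computable f) : Computable fun x => |f x| :=
  computable_max hf (computable_neg hf)

end RatComputability

namespace ZigzagAttractor

section Dynamics

lemma omegaSet_iterate {X : Type*} [TopologicalSpace X] (T : X → X) (x : X) (n : ℕ) :
    omegaSet T (T^[n] x) = omegaSet T x := by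
  ext y
  have h : (fun k => T^[k] (T^[n] x)) = (fun k => T^[k] x) ∘ (· + n) := by
    funext k; simp [Function.iterate_add_apply]
  simp only [omegaSet, mem_ofPred_eq, MapClusterPt, h, ← Filter.map_map,
    Filter.map_add_atTop_eq_nat]

lemma isClosed_omegaSet {X : Type*} [TopologicalSpace X] (T : X → X) (x : X) :
    IsClosed (omegaSet T x) :=
  isClosed_setOfPred_clusterPt

lemma mapsTo_omegaSet {X : Type*} [TopologicalSpace X] {T : X → X} (hT : Continuous T) (x : X) :
    MapsTo T (omegaSet T x) (omegaSet T x) := by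
  intro y hy
  rw [← omegaSet_iterate T x 1]
  have h : (fun k => T^[k] (T^[1] x)) = T ∘ fun k => T^[k] x := by
    funext k
    exact Function.Commute.iterate_self T k x
  have hy' : MapClusterPt y atTop fun n => T^[n] x := hy
  change MapClusterPt (T y) atTop fun k => T^[k] (T^[1] x)
  rw [h]
  exact hy'.continuousAt_comp hT.continuousAt

/-- If almost every orbit passes through `c`, the `ω`-limit set of `c` is a metric attractor. -/
lemma isMetricAttractor_omegaSet {X : Type*} [TopologicalSpace X] [MeasurableSpace X]
    {T : X → X} (hT : Continuous T) (lam : Measure X) [IsProbabilityMeasure lam] (c : X)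
    (h : ∀ᵐ x ∂lam, ∃ n, T^[n] x = c) : IsMetricAttractor T lam (omegaSet T c) := by
  refine ⟨isClosed_omegaSet T c, mapsTo_omegaSet hT c, ?_, fun A' _ hA' => ?_⟩
  · have : realm T (omegaSet T c) =ᵐ[lam] univ := by
      rw [eventuallyEq_univ]
      filter_upwards [h] with x ⟨n, hn⟩
      change omegaSet T x ⊆ omegaSet T c
      rw [← hn, omegaSet_iterate]
    rw [measure_congr this, measure_univ]
  · refine measure_mono_null (fun x hx => ?_) (ae_iff.1 h)
    rintro ⟨n, hn⟩
    have hx' : omegaSet T x ⊆ A' := hx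
    rw [← omegaSet_iterate T x n, hn] at hx'
    exact hA'.2 hx'

/-- The zigzag with full branches on `[0, 1]`, `[1, 2]`, `[2, 3]`, truncated below at height `c`
on `[3, ∞)`. -/
noncomputable def zigzag (c y : ℝ) : ℝ :=
  max (min |y| (2 - y)) (min (y - 2) (max (4 - y) c))

lemma abs_zigzag_sub_le (c c' y y' : ℝ) :
    |zigzag c y - zigzag c' y'| ≤ max |y - y'| |c - c'| := by
  unfold zigzag
  have h1 : |(2 - y) - (2 - y')| = |y - y'| := by
    rw [show (2 - y) - (2 - y') = -(y - y') by ring, abs_neg]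
  have h2 : |(4 - y) - (4 - y')| = |y - y'| := by
    rw [show (4 - y) - (4 - y') = -(y - y') by ring, abs_neg]
  have h3 : |(y - 2) - (y' - 2)| = |y - y'| := by congr 1; ring
  refine (abs_max_sub_max_le_max _ _ _ _).trans (max_le ?_ ?_)
  · refine (abs_min_sub_min_le_max _ _ _ _).trans (max_le ?_ ?_)
    · exact (abs_abs_sub_abs_le_abs_sub y y').trans (le_max_left _ _)
    · exact h1.trans_le (le_max_left _ _)
  · refine (abs_min_sub_min_le_max _ _ _ _).trans (max_le ?_ ?_)
    · exact h3.trans_le (le_max_left _ _)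
    · exact (abs_max_sub_max_le_max _ _ _ _).trans (max_le (h2.trans_le (le_max_left _ _))
        (le_max_right _ _))

lemma continuous_zigzag (c : ℝ) : Continuous (zigzag c) := by
  unfold zigzag; fun_prop

variable {c y : ℝ}

lemma zigzag_of_le_one (h : y ≤ 1) (h' : -1 ≤ y) : zigzag c y = |y| := by
  unfold zigzag
  have h1 : |y| ≤ 1 := abs_le.2 ⟨h', h⟩
  rw [min_eq_left (by linarith), max_eq_left ((min_le_left _ _).trans (by linarith [abs_nonneg y]))]

lemma zigzag_of_le_two (h : 1 ≤ y) (h' : y ≤ 2) : zigzag c y = 2 - y := by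
  unfold zigzag
  rw [abs_of_nonneg (by linarith), min_eq_right (by linarith),
    max_eq_left ((min_le_left _ _).trans (by linarith))]

lemma zigzag_of_le_three (h : 2 ≤ y) (h' : y ≤ 3) : zigzag c y = y - 2 := by
  unfold zigzag
  rw [abs_of_nonneg (by linarith), min_eq_right (by linarith),
    min_eq_left (le_max_of_le_left (by linarith)), max_eq_right (by linarith)]

lemma zigzag_of_three_le (h0 : 0 ≤ c) (h1 : c ≤ 1) (h : 3 ≤ y) :
    zigzag c y = max (4 - y) c := by
  unfold zigzag
  rw [abs_of_nonneg (by linarith), min_eq_right (by linarith),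
    min_eq_right (max_le (by linarith) (by linarith)),
    max_eq_right (le_max_of_le_right (by linarith))]

lemma zigzag_mem_Icc (h0 : 0 ≤ c) (h1 : c ≤ 1) (h : -1 ≤ y) : zigzag c y ∈ Icc (0 : ℝ) 1 := by
  rcases le_total y 1 with h2 | h2
  · rw [zigzag_of_le_one h2 h]; exact ⟨abs_nonneg y, abs_le.2 ⟨h, h2⟩⟩
  rcases le_total y 2 with h3 | h3
  · rw [zigzag_of_le_two h2 h3]; constructor <;> linarith
  rcases le_total y 3 with h4 | h4
  · rw [zigzag_of_le_three h3 h4]; constructor <;> linarith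
  · rw [zigzag_of_three_le h0 h1 h4]
    exact ⟨le_max_of_le_right h0, max_le (by linarith) h1⟩

/-- The interval map `x ↦ zigzag c (8 x - t)`. -/
noncomputable def zigzagMap (t c x : ℝ) : ℝ := zigzag c (8 * x - t)

variable {t : ℝ}

lemma continuous_zigzagMap (t c : ℝ) : Continuous (zigzagMap t c) :=
  (continuous_zigzag c).comp (by fun_prop)

lemma mapsTo_zigzagMap (h0 : 0 ≤ c) (h1 : c ≤ 1) (ht : t ≤ 1) :
    MapsTo (zigzagMap t c) (Icc 0 1) (Icc 0 1) :=
  fun x hx => zigzag_mem_Icc h0 h1 (by linarith [hx.1])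

lemma volume_preimage_affine {a : ℝ} (ha : a ≠ 0) (b : ℝ) (S : Set ℝ) :
    volume ((fun x => a * x + b) ⁻¹' S) = ENNReal.ofReal |a⁻¹| * volume S := by
  rw [← measure_preimage_add_right volume b S, ← Real.volume_preimage_mul_left ha]
  rfl

/-- Almost every orbit of the zigzag map eventually hits `c`. -/
lemma ae_exists_iterate_zigzagMap_eq (h0 : 0 ≤ c) (h1 : c ≤ 1) (ht : t ≤ 1) :
    ∀ᵐ x ∂volume.restrict (Icc (0 : ℝ) 1), ∃ n, (zigzagMap t c)^[n] x = c := by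
  set S : Set ℝ := {x | x ∈ Icc (0 : ℝ) 1 ∧ ∀ n, (zigzagMap t c)^[n] x ≠ c} with hS
  have hmap : ∀ x ∈ S, zigzagMap t c x ∈ S ∧ zigzagMap t c x ≠ c := fun x hx =>
    ⟨⟨mapsTo_zigzagMap h0 h1 ht hx.1, fun n => hx.2 (n + 1)⟩, hx.2 1⟩
  have hsub : S ⊆ (((((fun x => -8 * x + t) ⁻¹' S) ∪ ((fun x => 8 * x + -t) ⁻¹' S)) ∪
      ((fun x => -8 * x + (2 + t)) ⁻¹' S)) ∪ ((fun x => 8 * x + (-t - 2)) ⁻¹' S)) ∪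
      ((fun x => -8 * x + (4 + t)) ⁻¹' S) := by
    intro x hx
    obtain ⟨h2, h3⟩ := hmap x hx
    have hxI := hx.1
    have key : ∀ y, y = zigzagMap t c x → y ∈ S := fun y hy => hy ▸ h2
    simp only [mem_union, mem_preimage]
    unfold zigzagMap at key h3
    rcases le_total (8 * x - t) 0 with h | h
    · refine Or.inl (Or.inl (Or.inl (Or.inl (key _ ?_))))
      rw [zigzag_of_le_one (by linarith) (by linarith [hxI.1]), abs_of_nonpos h]; ring
    rcases le_total (8 * x - t) 1 with h' | h'
    · refine Or.inl (Or.inl (Or.inl (Or.inr (key _ ?_))))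
      rw [zigzag_of_le_one h' (by linarith), abs_of_nonneg h]; ring
    rcases le_total (8 * x - t) 2 with h'' | h''
    · refine Or.inl (Or.inl (Or.inr (key _ ?_)))
      rw [zigzag_of_le_two h' h'']; ring
    rcases le_total (8 * x - t) 3 with h4 | h4
    · refine Or.inl (Or.inr (key _ ?_))
      rw [zigzag_of_le_three h'' h4]; ring
    · refine Or.inr (key _ ?_)
      rw [zigzag_of_three_le h0 h1 h4] at h3 ⊢
      rcases le_total (4 - (8 * x - t)) c with h5 | h5
      · exact absurd (max_eq_right h5) h3
      · rw [max_eq_left h5]; ring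
  have hle : volume S ≤ ENNReal.ofReal (5 / 8) * volume S := by
    have h8 : |(8 : ℝ)⁻¹| = 1 / 8 := by rw [abs_of_pos (by norm_num)]; norm_num
    have h8' : |(-8 : ℝ)⁻¹| = 1 / 8 := by rw [abs_of_neg (by norm_num)]; norm_num
    calc volume S ≤ _ := measure_mono hsub
      _ ≤ (((_ + _) + _) + _) + _ := (measure_union_le _ _).trans (add_le_add_left
          ((measure_union_le _ _).trans (add_le_add_left
          ((measure_union_le _ _).trans (add_le_add_left (measure_union_le _ _) _)) _)) _)
      _ = ENNReal.ofReal (5 / 8) * volume S := by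
        simp only [volume_preimage_affine (show (8 : ℝ) ≠ 0 by norm_num),
          volume_preimage_affine (show (-8 : ℝ) ≠ 0 by norm_num), h8, h8', ← add_mul]
        congr 1
        simp only [← ENNReal.ofReal_add (show (0 : ℝ) ≤ 1 / 8 by norm_num)
          (show (0 : ℝ) ≤ 1 / 8 by norm_num)]
        repeat rw [← ENNReal.ofReal_add (by norm_num) (by norm_num)]
        norm_num
  have hfin : volume S ≠ ⊤ :=
    ((measure_mono fun x hx => hx.1 : volume S ≤ volume (Icc (0 : ℝ) 1)).trans_lt
      (by simp)).ne
  have hzero : volume S = 0 := by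
    by_contra hne
    have : ENNReal.ofReal (5 / 8) * volume S < 1 * volume S :=
      ENNReal.mul_lt_mul_left hne hfin (by
        rw [ENNReal.ofReal_lt_one]; norm_num)
    rw [one_mul] at this
    exact absurd hle (not_le.2 this)
  rw [ae_restrict_iff' measurableSet_Icc, ae_iff]
  refine measure_mono_null (fun x hx => ?_) hzero
  simp only [mem_ofPred_eq, Classical.not_imp, not_exists] at hx
  exact ⟨hx.1, hx.2⟩

end Dynamics

end ZigzagAttractor

namespace ZigzagAttractor

section Digits

variable (p : ℕ → Bool)

/-- The `0`-`1` sequence with ones at the squares `s ^ 2` and, when `p s` holds, at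
`s ^ 2 + e + 1`, where `e` is the first component of the pair coded by `s`. -/
def digit (n : ℕ) : ℕ :=
  if n = n.sqrt * n.sqrt ∨ (n = n.sqrt * n.sqrt + n.sqrt.unpair.1 + 1 ∧ p n.sqrt = true)
  then 1 else 0

/-- The number with octal digits `2 * digit p n`, `2 * digit p (n + 1)`, … -/
noncomputable def octal (n : ℕ) : ℝ := ∑' i, 2 * (digit p (n + i) : ℝ) / 8 ^ (i + 1)

variable {p}

lemma digit_eq_one_iff {n : ℕ} : digit p n = 1 ↔
    n = n.sqrt * n.sqrt ∨ (n = n.sqrt * n.sqrt + n.sqrt.unpair.1 + 1 ∧ p n.sqrt = true) := by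
  unfold digit; split_ifs with h <;> simp [h]

lemma digit_eq_zero_or_one (n : ℕ) : digit p n = 0 ∨ digit p n = 1 := by
  unfold digit; split_ifs <;> simp

lemma octal_term_le (n i : ℕ) : 2 * (digit p (n + i) : ℝ) / 8 ^ (i + 1) ≤ 1 / 4 * (1 / 8) ^ i := by
  have h : (digit p (n + i) : ℝ) ≤ 1 := by
    rcases digit_eq_zero_or_one (p := p) (n + i) with h | h <;> simp [h]
  rw [div_le_iff₀ (by positivity), pow_succ, one_div_pow]
  field_simp
  linarith

lemma summable_octal (n : ℕ) : Summable fun i => 2 * (digit p (n + i) : ℝ) / 8 ^ (i + 1) :=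
  Summable.of_nonneg_of_le (fun _ => by positivity) (octal_term_le n)
    ((summable_geometric_of_lt_one (by norm_num) (by norm_num)).mul_left _)

lemma octal_nonneg (n : ℕ) : 0 ≤ octal p n := tsum_nonneg fun _ => by positivity

lemma octal_le (n : ℕ) : octal p n ≤ 2 / 7 := by
  refine ((summable_octal n).tsum_le_tsum (octal_term_le n)
    ((summable_geometric_of_lt_one (by norm_num) (by norm_num)).mul_left _)).trans ?_
  rw [tsum_mul_left, tsum_geometric_of_lt_one (by norm_num) (by norm_num)]
  norm_num

lemma octal_eq (n : ℕ) : octal p n = (2 * digit p n + octal p (n + 1)) / 8 := by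
  unfold octal
  rw [(summable_octal n).tsum_eq_zero_add, add_div, ← tsum_div_const]
  congr 1
  · simp
  · refine tsum_congr fun i => ?_
    rw [show n + (i + 1) = n + 1 + i by ring, pow_succ _ (i + 1), div_div]

lemma octal_eq_of_digit_eq_zero {n : ℕ} (h : digit p n = 0) : octal p n = octal p (n + 1) / 8 := by
  rw [octal_eq, h]; simp

lemma octal_eq_of_digit_eq_one {n : ℕ} (h : digit p n = 1) :
    octal p n = 1 / 4 + octal p (n + 1) / 8 := by
  rw [octal_eq, h]; push_cast; ring

lemma octal_eq_sum_add (n k : ℕ) : octal p n =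
    ∑ i ∈ Finset.range k, 2 * (digit p (n + i) : ℝ) / 8 ^ (i + 1) + octal p (n + k) / 8 ^ k := by
  induction k with
  | zero => simp
  | succ k ih =>
    rw [ih, Finset.sum_range_succ, octal_eq (n + k), add_assoc n k 1]
    ring

/-- The integer with the first `k` octal digits of `octal p n`. -/
def octalNum (p : ℕ → Bool) (n k : ℕ) : ℕ :=
  Nat.rec 0 (fun k a => 8 * a + 2 * digit p (n + k)) k

lemma octal_eq_octalNum_add (n k : ℕ) :
    octal p n = octalNum p n k / 8 ^ k + octal p (n + k) / 8 ^ k := by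
  induction k with
  | zero => simp [octalNum]
  | succ k ih =>
    rw [ih, octal_eq (n + k), add_assoc n k 1]
    change _ = ((8 * octalNum p n k + 2 * digit p (n + k) : ℕ) : ℝ) / 8 ^ (k + 1) + _
    push_cast
    field_simp
    ring

lemma abs_octal_sub_le (n k : ℕ) : |octal p n - octalNum p n k / 8 ^ k| ≤ 1 / 2 ^ k := by
  rw [octal_eq_octalNum_add n k, add_sub_cancel_left, abs_of_nonneg
    (div_nonneg (octal_nonneg _) (by positivity))]
  exact div_le_div₀ zero_le_one ((octal_le _).trans (by norm_num)) (by positivity)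
    (pow_le_pow_left₀ (by norm_num) (by norm_num) k)

lemma sqrt_mul_self_add {s a : ℕ} (h : a ≤ 2 * s) : (s * s + a).sqrt = s :=
  Nat.sqrt_add_eq s (by omega)

lemma digit_sq (s : ℕ) : digit p (s * s) = 1 :=
  digit_eq_one_iff.2 (Or.inl (by rw [Nat.sqrt_eq]))

lemma digit_sq_add {s a : ℕ} (h : a < 2 * s) :
    digit p (s * s + a + 1) = 1 ↔ a = s.unpair.1 ∧ p s = true := by
  rw [digit_eq_one_iff, add_assoc, sqrt_mul_self_add (show a + 1 ≤ 2 * s by omega)]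
  have : ¬ s * s + (a + 1) = s * s := by omega
  simp only [this, false_or]
  refine and_congr_left fun _ => ?_
  omega

lemma octal_sq {s e : ℕ} (he : s.unpair.1 = e) (hs : 0 < s) (hp : p s = true) :
    octal p (s * s) - 1 / 4 ∈ Icc (1 / 4 * (1 / 8 : ℝ) ^ (e + 1)) (2 / 7 * (1 / 8) ^ (e + 1)) := by
  have hes : e ≤ s := he ▸ Nat.unpair_left_le s
  have h : ∀ i ≤ e, octal p (s * s) - 1 / 4 = (1 / 8) ^ (i + 1) * octal p (s * s + i + 1) := by
    intro i
    induction i with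
    | zero => intro _; rw [octal_eq_of_digit_eq_one (digit_sq s)]; ring_nf
    | succ i ih =>
      intro hi
      have h0 : digit p (s * s + i + 1) = 0 := by
        refine (digit_eq_zero_or_one _).resolve_right fun h => ?_
        have := ((digit_sq_add (by omega)).1 h).1
        omega
      rw [ih (by omega), octal_eq_of_digit_eq_zero h0, ← add_assoc]
      ring
  have h1 : digit p (s * s + e + 1) = 1 := (digit_sq_add (by omega)).2 ⟨he.symm, hp⟩
  have h2 := octal_eq_of_digit_eq_one h1
  have h3 := octal_nonneg (p := p) (s * s + e + 1 + 1)
  rw [h e le_rfl, mul_comm ((1 / 8 : ℝ) ^ (e + 1)) (octal p _)]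
  have h4 : (0 : ℝ) < (1 / 8) ^ (e + 1) := by positivity
  exact ⟨mul_le_mul_of_nonneg_right (by linarith) h4.le,
    mul_le_mul_of_nonneg_right (octal_le _) h4.le⟩

lemma digit_eq_one_of_octal_mem {n h : ℕ}
    (hn : octal p n ∈ Ioo (5 / 32 * (1 / 8 : ℝ) ^ h) (13 / 32 * (1 / 8) ^ h)) :
    digit p (n + h) = 1 := by
  induction h generalizing n with
  | zero =>
    refine (digit_eq_zero_or_one _).resolve_left fun h0 => ?_
    have h1 := octal_eq_of_digit_eq_zero h0
    have h2 := octal_le (p := p) (n + 1)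
    have h3 := hn.1
    rw [add_zero] at h1
    norm_num at h3
    linarith
  | succ h ih =>
    have hpow : (1 / 8 : ℝ) ^ h ≤ 1 := pow_le_one₀ (by norm_num) (by norm_num)
    rw [pow_succ] at hn
    have h0 : digit p n = 0 := by
      refine (digit_eq_zero_or_one _).resolve_right fun h1 => ?_
      have h2 := octal_eq_of_digit_eq_one h1
      have h3 := octal_nonneg (p := p) (n + 1)
      linarith [hn.2]
    have h1 := octal_eq_of_digit_eq_zero h0
    rw [show n + (h + 1) = n + 1 + h by ring]
    exact ih ⟨by linarith [hn.1], by linarith [hn.2]⟩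

lemma eq_of_octal_sub_mem {n e : ℕ} (hs : e + 2 ≤ n.sqrt) (hn : octal p n - 1 / 4 ∈
      Ioo (5 / 32 * (1 / 8 : ℝ) ^ (e + 1)) (13 / 32 * (1 / 8) ^ (e + 1))) :
    n.sqrt.unpair.1 = e ∧ p n.sqrt = true := by
  rw [pow_succ] at hn
  have hpow : (0 : ℝ) < (1 / 8 : ℝ) ^ e := by positivity
  have h1 : digit p n = 1 := by
    refine (digit_eq_zero_or_one _).resolve_left fun h0 => ?_
    have h1 := octal_eq_of_digit_eq_zero h0
    have h2 := octal_le (p := p) (n + 1)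
    linarith [hn.1]
  have h2 := octal_eq_of_digit_eq_one h1
  have h3 : digit p (n + 1 + e) = 1 :=
    digit_eq_one_of_octal_mem ⟨by linarith [hn.1], by linarith [hn.2]⟩
  have hu := Nat.unpair_left_le n.sqrt
  rcases digit_eq_one_iff.1 h1 with h | ⟨h, hp⟩
  · rw [show n + 1 + e = n.sqrt * n.sqrt + e + 1 by omega, digit_sq_add (by omega)] at h3
    exact ⟨h3.1.symm, h3.2⟩
  · rw [show n + 1 + e = n.sqrt * n.sqrt + (n.sqrt.unpair.1 + 1 + e) + 1 by omega,
      digit_sq_add (by omega)] at h3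
    omega

end Digits

section Limits

open scoped Pointwise

/-- Sums of at most `k` powers of `1 / 8`, together with their limit points. -/
def powerSums : ℕ → Set ℝ
  | 0 => {0}
  | k + 1 => insert 0 (range fun j : ℕ => (1 / 8 : ℝ) ^ j) + powerSums k

lemma isCompact_powerSums (k : ℕ) : IsCompact (powerSums k) := by
  induction k with
  | zero => exact isCompact_singleton
  | succ k ih =>
    exact (tendsto_pow_atTop_nhds_zero_of_lt_one (by norm_num)
      (by norm_num)).isCompact_insert_range.add ih

lemma powerSums_subset_range_ratCast (k : ℕ) : powerSums k ⊆ range ((↑) : ℚ → ℝ) := by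
  induction k with
  | zero => rintro _ rfl; exact ⟨0, by simp⟩
  | succ k ih =>
    rintro _ ⟨a, ha, b, hb, rfl⟩
    obtain ⟨q, rfl⟩ := ih hb
    rcases ha with rfl | ⟨j, rfl⟩
    · exact ⟨q, by simp⟩
    · exact ⟨(1 / 8) ^ j + q, by push_cast; rfl⟩

lemma sum_mem_powerSums (T : Finset ℕ) {k : ℕ} (hT : T.card ≤ k) :
    ∑ i ∈ T, (1 / 8 : ℝ) ^ i ∈ powerSums k := by
  induction k generalizing T with
  | zero =>
    rw [Finset.card_eq_zero.1 (Nat.le_zero.1 hT)]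
    simp [powerSums]
  | succ k ih =>
    rcases T.eq_empty_or_nonempty with rfl | ⟨a, ha⟩
    · exact ⟨0, mem_insert _ _, 0, by simpa using ih ∅ (by simp), by simp⟩
    · rw [← Finset.add_sum_erase T _ ha]
      exact add_mem_add (mem_insert_of_mem _ ⟨a, rfl⟩)
        (ih _ (by rw [Finset.card_erase_of_mem ha]; omega))

variable {p : ℕ → Bool}

lemma card_filter_digit_le (n : ℕ) :
    ((Finset.range n.sqrt).filter fun i => digit p (n + i) = 1).card ≤ 4 := by
  set s := n.sqrt with hs
  rw [← Finset.card_image_of_injective _ (add_right_injective n)]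
  refine (Finset.card_le_card (t := {s * s, s * s + s.unpair.1 + 1, (s + 1) * (s + 1),
    (s + 1) * (s + 1) + (s + 1).unpair.1 + 1}) fun m hm => ?_).trans Finset.card_le_four
  obtain ⟨i, hi, rfl⟩ := Finset.mem_image.1 hm
  rw [Finset.mem_filter, Finset.mem_range, digit_eq_one_iff] at hi
  obtain ⟨hi, h⟩ := hi
  have h1 : s * s ≤ n := Nat.sqrt_le n
  have h2 : n < (s + 1) * (s + 1) := Nat.lt_succ_sqrt n
  have h3 : s ≤ (n + i).sqrt := Nat.le_sqrt.2 (by omega)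
  have h4 : (n + i).sqrt < s + 2 := Nat.sqrt_lt.2 (by nlinarith)
  simp only [Finset.mem_insert, Finset.mem_singleton]
  obtain h5 | h5 : (n + i).sqrt = s ∨ (n + i).sqrt = s + 1 := by omega
  · rw [h5] at h; tauto
  · rw [h5] at h; tauto

lemma exists_powerSums_near (n : ℕ) :
    ∃ b ∈ powerSums 4, |4 * octal p n - b| ≤ 4 * (1 / 8) ^ n.sqrt := by
  refine ⟨_, sum_mem_powerSums _ (card_filter_digit_le (p := p) n), ?_⟩
  rw [octal_eq_sum_add n n.sqrt, Finset.sum_filter, mul_add, Finset.mul_sum]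
  have : ∀ i, 4 * (2 * (digit p (n + i) : ℝ) / 8 ^ (i + 1)) =
      if digit p (n + i) = 1 then (1 / 8) ^ i else 0 := by
    intro i
    rcases digit_eq_zero_or_one (p := p) (n + i) with h | h
    · simp [h]
    · simp only [h, if_true, Nat.cast_one, one_div_pow, pow_succ]; field_simp; norm_num
  simp only [this, add_sub_cancel_left]
  rw [abs_of_nonneg (by have := octal_nonneg (p := p) (n + n.sqrt); positivity), one_div_pow,
    ← mul_one_div (octal p _)]
  have h1 := octal_le (p := p) (n + n.sqrt)
  have h2 : (0 : ℝ) < 1 / 8 ^ n.sqrt := by positivity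
  nlinarith

lemma tendsto_sqrt_atTop : Tendsto Nat.sqrt atTop atTop :=
  tendsto_atTop.2 fun b => (eventually_ge_atTop (b * b)).mono fun _ h => Nat.le_sqrt.2 h

/-- Every accumulation point of `octal p` is rational. -/
lemma mem_range_ratCast_of_mapClusterPt {y : ℝ} (hy : MapClusterPt y atTop (octal p)) :
    y ∈ range ((↑) : ℚ → ℝ) := by
  obtain ⟨φ, hφ, hlim⟩ := hy.tendsto_subseq
  choose b hb hbn using exists_powerSums_near (p := p)
  have h0 : Tendsto (fun n : ℕ => 4 * (1 / 8 : ℝ) ^ n.sqrt) atTop (𝓝 0) := by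
    simpa using ((tendsto_pow_atTop_nhds_zero_of_lt_one (r := (1 / 8 : ℝ)) (by norm_num)
      (by norm_num)).comp tendsto_sqrt_atTop).const_mul 4
  have h1 : Tendsto (fun n => 4 * octal p n - b n) atTop (𝓝 0) :=
    squeeze_zero_norm hbn h0
  have h2 : Tendsto (fun k => b (φ k)) atTop (𝓝 (4 * y)) := by
    simpa using (hlim.const_mul 4).sub (h1.comp hφ.tendsto_atTop)
  obtain ⟨q, hq⟩ := powerSums_subset_range_ratCast 4 ((isCompact_powerSums 4).isClosed.mem_of_tendsto
    h2 (Eventually.of_forall fun k => hb (φ k)))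
  exact ⟨q / 4, by push_cast; rw [hq]; ring⟩

variable {τ : ℝ}

lemma zigzagMap_add_octal (h0 : 0 ≤ τ) (h1 : τ ≤ 1 / 7) (c : ℝ) (n : ℕ) :
    zigzagMap (7 * τ) c (τ + octal p n) = τ + octal p (n + 1) := by
  have h2 := octal_nonneg (p := p) (n + 1)
  have h3 := octal_le (p := p) (n + 1)
  unfold zigzagMap
  rcases digit_eq_zero_or_one (p := p) n with h | h
  · rw [octal_eq_of_digit_eq_zero h, zigzag_of_le_one (by linarith) (by linarith),
      abs_of_nonneg (by linarith)]
    ring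
  · rw [octal_eq_of_digit_eq_one h, zigzag_of_le_three (by linarith) (by linarith)]
    ring

lemma iterate_zigzagMap_add_octal (h0 : 0 ≤ τ) (h1 : τ ≤ 1 / 7) (c : ℝ) (n : ℕ) :
    (zigzagMap (7 * τ) c)^[n] (τ + octal p 0) = τ + octal p n := by
  induction n with
  | zero => rfl
  | succ n ih => rw [Function.iterate_succ_apply', ih, zigzagMap_add_octal h0 h1]

end Limits

end ZigzagAttractor

namespace ZigzagAttractor

open RatComputability Nat.Partrec

section Computability

lemma computableRealMap_zigzagMap {t c : ℝ} {T C : ℕ → ℚ} (hT : Computable T) (hC : Computable C)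
    (hTt : ∀ k, |t - T k| ≤ 1 / 2 ^ k) (hCc : ∀ k, |c - C k| ≤ 1 / 2 ^ k) :
    ComputableRealMap (zigzagMap t c) := by
  let Y : ℚ × ℕ → ℚ := fun x => 8 * x.1 - T (x.2 + 1)
  have hY : Computable Y := computable_sub (computable_mul (Computable.const 8) Computable.fst)
    (hT.comp (Computable.succ.comp Computable.snd))
  refine ⟨fun n => n + 4,
    fun x => max (min |Y x| (2 - Y x)) (min (Y x - 2) (max (4 - Y x) (C x.2))),
    (Primrec.nat_add.comp Primrec.id (Primrec.const 4)).to_comp,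
    computable_max (computable_min (computable_abs hY) (computable_sub (Computable.const 2) hY))
      (computable_min (computable_sub hY (Computable.const 2))
        (computable_max (computable_sub (Computable.const 4) hY) (hC.comp Computable.snd))),
    fun x _ q n hq => ?_⟩
  have hcast : ((max (min |Y (q, n)| (2 - Y (q, n)))
      (min (Y (q, n) - 2) (max (4 - Y (q, n)) (C n))) : ℚ) : ℝ) =
      zigzag (C n) (8 * q - T (n + 1)) := by
    simp only [zigzag, Y]
    push_cast
    rfl
  change |zigzag c (8 * x - t) - ((max (min |Y (q, n)| (2 - Y (q, n)))
      (min (Y (q, n) - 2) (max (4 - Y (q, n)) (C n))) : ℚ) : ℝ)| ≤ _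
  rw [hcast]
  refine (abs_zigzag_sub_le _ _ _ _).trans (max_le ?_ (hCc n))
  have h1 := hTt (n + 1)
  rw [pow_add, ← div_div] at hq
  rw [pow_succ, ← div_div] at h1
  rw [abs_le] at *
  constructor <;> linarith [hq.1, hq.2, h1.1, h1.2]

/-- If a computable bounded sequence of reals has only irrational accumulation points, then the
rational open intervals that contain an accumulation point form a `Π₂` set. -/
lemma piTwo_mapClusterPt {x : ℕ → ℝ} {X : ℕ → ℚ} (hX : Computable X)
    (hxX : ∀ n, |x n - X n| ≤ 1 / 2 ^ n)
    (hirr : ∀ y, MapClusterPt y atTop x → Irrational y) :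
    PiTwo {p : ℚ × ℚ | p.1 < p.2 ∧
      (Ioo (p.1 : ℝ) (p.2 : ℝ) ∩ {y | MapClusterPt y atTop x}).Nonempty} := by
  have hb : Computable fun i : (ℚ × ℚ) × ℕ × ℕ => i.2.2 := Computable.snd.comp Computable.snd
  have h1 : Computable fun i : (ℚ × ℚ) × ℕ × ℕ => i.1.1 := Computable.fst.comp Computable.fst
  have h2 : Computable fun i : (ℚ × ℚ) × ℕ × ℕ => i.1.2 := Computable.snd.comp Computable.fst
  have hpow := computable_inv_pow 2 two_pos hb
  refine ⟨fun i => (!decide (i.1.2 ≤ i.1.1)) && (decide (i.2.1 ≤ i.2.2) &&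
      (decide (i.1.1 - 1 / (2 : ℕ) ^ i.2.2 ≤ X i.2.2) &&
        decide (X i.2.2 ≤ i.1.2 + 1 / (2 : ℕ) ^ i.2.2))),
    Primrec.and.to_comp.comp (Primrec.not.to_comp.comp (computable_decide_le h2 h1))
      (Primrec.and.to_comp.comp (Primrec.nat_le.decide.to_comp.comp
          (Computable.fst.comp Computable.snd) hb)
        (Primrec.and.to_comp.comp (computable_decide_le (computable_sub h1 hpow) (hX.comp hb))
          (computable_decide_le (hX.comp hb) (computable_add h2 hpow)))), ?_⟩
  rintro ⟨a, b⟩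
  have hcast : ∀ n : ℕ, a - 1 / (2 : ℕ) ^ n ≤ X n ∧ X n ≤ b + 1 / (2 : ℕ) ^ n ↔
      (a : ℝ) - 1 / 2 ^ n ≤ X n ∧ (X n : ℝ) ≤ b + 1 / 2 ^ n := by
    intro n
    rw [← Rat.cast_le (K := ℝ), ← Rat.cast_le (K := ℝ)]
    push_cast
    rfl
  simp only [mem_ofPred_eq, Bool.and_eq_true, Bool.not_eq_true', decide_eq_false_iff_not,
    decide_eq_true_eq, not_le, hcast]
  constructor
  · rintro ⟨hab, y, hy, hyx⟩ N
    have hfr := hyx.frequently (isOpen_Ioo.mem_nhds hy)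
    obtain ⟨n, hn, hxn⟩ := (frequently_atTop.1 hfr) N
    have := abs_le.1 (hxX n)
    exact ⟨n, hab, hn, by linarith [hxn.1], by linarith [hxn.2]⟩
  · intro h
    have hab : a < b := (h 0).choose_spec.1
    obtain ⟨φ, hφ, hφx⟩ := extraction_of_frequently_atTop (frequently_atTop.2 fun N =>
      (h N).imp fun n hn => hn.2)
    have hle : ∀ k, (a : ℝ) - 2 * (1 / 2) ^ φ k ≤ x (φ k) ∧ x (φ k) ≤ b + 2 * (1 / 2) ^ φ k := by
      intro k
      have h1 := abs_le.1 (hxX (φ k))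
      have h2 := hφx k
      rw [one_div_pow]
      constructor <;> linarith [h1.1, h1.2, h2.1, h2.2]
    have hK : ∀ k, x (φ k) ∈ Icc ((a : ℝ) - 2) (b + 2) := by
      intro k
      have : (1 / 2 : ℝ) ^ φ k ≤ 1 := pow_le_one₀ (by norm_num) (by norm_num)
      constructor <;> linarith [(hle k).1, (hle k).2]
    obtain ⟨y, -, ψ, hψ, hlim⟩ := isCompact_Icc.tendsto_subseq hK
    have htop : Tendsto (φ ∘ ψ) atTop atTop := (hφ.comp hψ).tendsto_atTop
    have hyx : MapClusterPt y atTop x := hlim.mapClusterPt.of_comp htop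
    have h0 : Tendsto (fun k => 2 * (1 / 2 : ℝ) ^ φ (ψ k)) atTop (𝓝 0) := by
      simpa using ((tendsto_pow_atTop_nhds_zero_of_lt_one (r := (1 / 2 : ℝ)) (by norm_num)
        (by norm_num)).comp htop).const_mul 2
    have hay : (a : ℝ) ≤ y := le_of_tendsto_of_tendsto' (by simpa using h0.const_sub (a : ℝ)) hlim
      fun k => (hle (ψ k)).1
    have hyb : y ≤ b := le_of_tendsto_of_tendsto' hlim (by simpa using h0.const_add (b : ℝ))
      fun k => (hle (ψ k)).2
    exact ⟨hab, y, ⟨hay.lt_of_ne' ((hirr y hyx).ne_rat a), hyb.lt_of_ne ((hirr y hyx).ne_rat b)⟩,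
      hyx⟩

variable {p : ℕ → Bool}

lemma computable_digit (hp : Computable p) : Computable (digit p) := by
  have hsq : Primrec fun n : ℕ => n.sqrt * n.sqrt :=
    Primrec.nat_mul.comp Primrec.nat_sqrt Primrec.nat_sqrt
  have hu : Primrec fun n : ℕ => n.sqrt * n.sqrt + n.sqrt.unpair.1 + 1 :=
    Primrec.succ.comp (Primrec.nat_add.comp hsq
      (Primrec.fst.comp (Primrec.unpair.comp Primrec.nat_sqrt)))
  have hb : Computable fun n : ℕ => decide (n = n.sqrt * n.sqrt) ||
      (decide (n = n.sqrt * n.sqrt + n.sqrt.unpair.1 + 1) && p n.sqrt) :=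
    Primrec.or.to_comp.comp (Primrec.eq.decide.comp Primrec.id hsq).to_comp
      (Primrec.and.to_comp.comp (Primrec.eq.decide.comp Primrec.id hu).to_comp
        (hp.comp Primrec.nat_sqrt.to_comp))
  refine (Computable.cond hb (Computable.const 1) (Computable.const 0)).of_eq fun n => ?_
  rw [Bool.cond_eq_ite, digit]
  simp only [Bool.or_eq_true, Bool.and_eq_true, decide_eq_true_eq]

lemma computable_octalNum (hp : Computable p) :
    Computable fun x : ℕ × ℕ => octalNum p x.1 x.2 := by
  have h : Computable fun y : (ℕ × ℕ) × ℕ × ℕ => 8 * y.2.2 + 2 * digit p (y.1.1 + y.2.1) :=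
    Primrec.nat_add.to_comp.comp
      (Primrec.nat_mul.to_comp.comp (Computable.const 8) (Computable.snd.comp Computable.snd))
      (Primrec.nat_mul.to_comp.comp (Computable.const 2) ((computable_digit hp).comp
        (Primrec.nat_add.to_comp.comp (Computable.fst.comp Computable.fst)
          (Computable.fst.comp Computable.snd))))
  exact Computable.nat_rec Computable.snd (Computable.const 0) h.to₂

/-- The offset of the attractor. -/
noncomputable def offset : ℝ := √2 / 14

/-- Dyadic approximations of `offset`. -/
def offsetApprox (k : ℕ) : ℚ := (Nat.sqrt (2 * (2 ^ k * 2 ^ k)) : ℚ) * (1 / 14) * (1 / (2 : ℕ) ^ k)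

lemma irrational_offset : Irrational offset := irrational_sqrt_two.div_natCast (m := 14) (by norm_num)

lemma offset_nonneg : 0 ≤ offset := by unfold offset; positivity

lemma offset_le : offset ≤ 1 / 7 := by
  have : √2 ≤ 2 := Real.sqrt_le_iff.2 (by norm_num)
  unfold offset; linarith

lemma abs_offset_sub_le (k : ℕ) : |offset - offsetApprox k| ≤ 1 / 2 ^ k := by
  have h1 := Real.nat_sqrt_le_real_sqrt (a := 2 * (2 ^ k * 2 ^ k))
  have h2 := Real.real_sqrt_lt_nat_sqrt_succ (a := 2 * (2 ^ k * 2 ^ k))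
  have hk : (0 : ℝ) < 2 ^ k := by positivity
  have h3 : √((2 * (2 ^ k * 2 ^ k) : ℕ) : ℝ) = √2 * 2 ^ k := by
    push_cast
    rw [Real.sqrt_mul zero_le_two, Real.sqrt_mul_self hk.le]
  rw [h3] at h1 h2
  unfold offset offsetApprox
  push_cast
  rw [abs_le]
  set r := ((Nat.sqrt (2 * (2 ^ k * 2 ^ k)) : ℕ) : ℝ)
  have h4 : √2 / 14 - r * (1 / 14) * (1 / 2 ^ k) = (√2 * 2 ^ k - r) / 14 * (1 / 2 ^ k) := by
    field_simp
  have h5 : (0 : ℝ) < 1 / 2 ^ k := by positivity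
  rw [h4]
  constructor
  · have : 0 ≤ (√2 * 2 ^ k - r) / 14 * (1 / 2 ^ k) := mul_nonneg (by linarith) h5.le
    linarith
  · exact mul_le_of_le_one_left h5.le (by linarith)

lemma computable_offsetApprox : Computable offsetApprox := by
  have hpow : Primrec fun k : ℕ => 2 ^ k :=
    (Primrec₂.unpaired'.1 Nat.Primrec.pow).comp (Primrec.const 2) Primrec.id
  exact computable_mul (computable_mul (computable_natCast (Primrec.nat_sqrt.comp
    (Primrec.nat_mul.comp (Primrec.const 2) (Primrec.nat_mul.comp hpow hpow))).to_comp)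
    (Computable.const (1 / 14))) (computable_inv_pow 2 two_pos Computable.id)

/-- Rational approximations of `offset + octal p n`. -/
def orbitApprox (p : ℕ → Bool) (n k : ℕ) : ℚ :=
  offsetApprox (k + 1) + octalNum p n (k + 1) * (1 / (8 : ℕ) ^ (k + 1))

lemma abs_orbit_sub_le (n k : ℕ) : |offset + octal p n - orbitApprox p n k| ≤ 1 / 2 ^ k := by
  have h1 := abs_offset_sub_le (k + 1)
  have h2 := abs_octal_sub_le (p := p) n (k + 1)
  unfold orbitApprox
  push_cast
  rw [mul_one_div]
  rw [pow_succ, ← div_div, abs_le] at h1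
  rw [pow_succ 2, ← div_div, abs_le] at h2
  rw [abs_le]
  constructor <;> linarith [h1.1, h1.2, h2.1, h2.2]

lemma computable_orbitApprox (hp : Computable p) :
    Computable fun x : ℕ × ℕ => orbitApprox p x.1 x.2 := by
  have hs : Computable fun x : ℕ × ℕ => x.2 + 1 := Computable.succ.comp Computable.snd
  exact computable_add (computable_offsetApprox.comp hs) (computable_mul
    (computable_natCast ((computable_octalNum hp).comp (Computable.fst.pair hs)))
    (computable_inv_pow 8 (by norm_num) hs))

end Computability

section Totality

open Nat.Partrec.Code Denumerable

/-- Whether the machine `M_e` halts within `j` steps on all inputs below `m`. -/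
def haltsBelow (e m j : ℕ) : Bool :=
  Nat.rec true (fun i b => b && (evaln j (ofNat Code e) i).isSome) m

lemma haltsBelow_iff {e m j : ℕ} :
    haltsBelow e m j = true ↔ ∀ i < m, (evaln j (ofNat Code e) i).isSome = true := by
  induction m with
  | zero => simp [haltsBelow]
  | succ m ih =>
    change (haltsBelow e m j && (evaln j (ofNat Code e) m).isSome) = true ↔ _
    rw [Bool.and_eq_true, ih, Nat.forall_lt_succ_right]

lemma haltsBelow_mono {e m j j' : ℕ} (hj : j ≤ j') (h : haltsBelow e m j = true) :
    haltsBelow e m j' = true := by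
  rw [haltsBelow_iff] at *
  intro i hi
  obtain ⟨x, hx⟩ := Option.isSome_iff_exists.1 (h i hi)
  exact Option.isSome_iff_exists.2 ⟨x, evaln_mono hj hx⟩

/-- Whether, for `s` coding `(e, m, j)`, the machine `M_e` needs exactly `j + 1` steps to halt on
all inputs below `m`. -/
def haltsAt (s : ℕ) : Bool :=
  haltsBelow s.unpair.1 s.unpair.2.unpair.1 (s.unpair.2.unpair.2 + 1) &&
    !haltsBelow s.unpair.1 s.unpair.2.unpair.1 s.unpair.2.unpair.2

lemma computable_haltsBelow : Computable fun x : (ℕ × ℕ) × ℕ => haltsBelow x.1.1 x.1.2 x.2 := by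
  have hx : Primrec fun y : ((ℕ × ℕ) × ℕ) × ℕ × Bool => ((y.1.2, ofNat Code y.1.1.1), y.2.1) :=
    ((Primrec.snd.comp Primrec.fst).pair ((Primrec.ofNat Code).comp
      (Primrec.fst.comp (Primrec.fst.comp Primrec.fst)))).pair (Primrec.fst.comp Primrec.snd)
  have hstep : Primrec fun y : ((ℕ × ℕ) × ℕ) × ℕ × Bool =>
      y.2.2 && (evaln y.1.2 (ofNat Code y.1.1.1) y.2.1).isSome :=
    Primrec.and.comp (Primrec.snd.comp Primrec.snd)
      (Primrec.option_isSome.comp (primrec_evaln.comp hx))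
  have hstep' : Computable₂ fun (x : (ℕ × ℕ) × ℕ) (y : ℕ × Bool) =>
      y.2 && (evaln x.2 (ofNat Code x.1.1) y.1).isSome := hstep.to_comp
  exact (Computable.nat_rec (Computable.snd.comp Computable.fst) (Computable.const true)
    hstep').of_eq fun _ => rfl

lemma computable_haltsAt : Computable haltsAt := by
  have he : Computable fun s : ℕ => s.unpair.1 := Computable.fst.comp Computable.unpair
  have hk : Computable fun s : ℕ => s.unpair.2.unpair :=
    Computable.unpair.comp (Computable.snd.comp Computable.unpair)
  have hm : Computable fun s : ℕ => s.unpair.2.unpair.1 := Computable.fst.comp hk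
  have hj : Computable fun s : ℕ => s.unpair.2.unpair.2 := Computable.snd.comp hk
  have h1 : Computable fun s : ℕ =>
      ((s.unpair.1, s.unpair.2.unpair.1), s.unpair.2.unpair.2 + 1) :=
    (he.pair hm).pair (Computable.succ.comp hj)
  have h2 := computable_haltsBelow.comp h1
  have h3 := computable_haltsBelow.comp ((he.pair hm).pair hj)
  exact (Primrec.and.to_comp.comp h2 (Primrec.not.to_comp.comp h3)).of_eq fun _ => rfl

lemma exists_haltsBelow {e : ℕ} (he : e ∈ TotSet) (m : ℕ) : ∃ j, haltsBelow e m j = true := by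
  induction m with
  | zero => exact ⟨0, rfl⟩
  | succ m ih =>
    obtain ⟨j, hj⟩ := ih
    obtain ⟨x, hx⟩ := Part.dom_iff_mem.1 (he m)
    obtain ⟨k, hk⟩ := evaln_complete.1 hx
    refine ⟨max j k, ?_⟩
    change (haltsBelow e m (max j k) && (evaln (max j k) (ofNat Code e) m).isSome) = true
    rw [Bool.and_eq_true]
    exact ⟨haltsBelow_mono (le_max_left _ _) hj,
      Option.isSome_iff_exists.2 ⟨x, evaln_mono (le_max_right _ _) hk⟩⟩

/-- A machine is total if and only if it halts on all longer and longer initial segments. -/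
lemma frequently_haltsAt_iff {e : ℕ} :
    (∃ᶠ s in atTop, s.unpair.1 = e ∧ haltsAt s = true) ↔ e ∈ TotSet := by
  rw [Nat.frequently_atTop_iff_infinite]
  constructor
  · intro hinf i
    by_contra hi
    refine hinf ((finite_le_nat i).of_injOn (f := fun s : ℕ => s.unpair.2.unpair.1) ?_ ?_)
    · rintro s ⟨rfl, hs⟩
      simp only [haltsAt, Bool.and_eq_true] at hs
      refine Nat.not_lt.1 fun hlt => hi ?_
      obtain ⟨x, hx⟩ := Option.isSome_iff_exists.1 (haltsBelow_iff.1 hs.1 i hlt)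
      exact Part.dom_iff_mem.2 ⟨x, evaln_sound hx⟩
    · rintro s ⟨hse, hs⟩ s' ⟨hse', hs'⟩ hm
      simp only at hm
      simp only [haltsAt, Bool.and_eq_true, Bool.not_eq_true'] at hs hs'
      rw [hse] at hs
      rw [hse', ← hm] at hs'
      have key : ∀ j j', haltsBelow e s.unpair.2.unpair.1 (j + 1) = true →
          haltsBelow e s.unpair.2.unpair.1 j' = false → j' ≤ j := fun j j' h h' =>
        Nat.not_lt.1 fun hlt => by simp [haltsBelow_mono hlt h] at h'
      have hj := le_antisymm (key _ _ hs'.1 hs.2) (key _ _ hs.1 hs'.2)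
      rw [← Nat.pair_unpair s, ← Nat.pair_unpair s', hse, hse', ← Nat.pair_unpair s.unpair.2,
        ← Nat.pair_unpair s'.unpair.2, hm, hj]
  · intro he
    have hex : ∀ m, ∃ j, haltsAt (Nat.pair e (Nat.pair (m + 1) j)) = true := by
      intro m
      have h := exists_haltsBelow he (m + 1)
      have h0 : haltsBelow e (m + 1) 0 = false := by
        rw [← Bool.not_eq_true, haltsBelow_iff]
        exact fun h => by simpa [evaln] using h 0 (Nat.succ_pos m)
      obtain ⟨j, hj⟩ : ∃ j, Nat.find h = j + 1 := Nat.exists_eq_succ_of_ne_zero fun hz => by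
        have := Nat.find_spec h
        rw [hz, h0] at this
        exact Bool.false_ne_true this
      refine ⟨j, ?_⟩
      simp only [haltsAt, Nat.unpair_pair, Bool.and_eq_true, Bool.not_eq_true']
      exact ⟨hj ▸ Nat.find_spec h, Bool.eq_false_iff.2 (Nat.find_min h (by omega))⟩
    choose j hj using hex
    refine infinite_of_injective_forall_mem (f := fun m => Nat.pair e (Nat.pair (m + 1) (j m)))
      (fun m m' h => ?_) fun m => ⟨by simp, hj m⟩
    simp only [Nat.pair_eq_pair] at h
    omega

end Totality

end ZigzagAttractor

namespace ZigzagAttractor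

open RatComputability

lemma inter_nonempty_iff_frequently {p : ℕ → Bool} {τ T : ℝ} {e : ℕ}
    (hT : |τ - T| ≤ 1 / 32 * (1 / 8) ^ (e + 1)) :
    (Ioo (1 / 4 + 3 / 16 * (1 / 8) ^ (e + 1) + T) (1 / 4 + 3 / 8 * (1 / 8) ^ (e + 1) + T) ∩
        {y | MapClusterPt y atTop fun n => τ + octal p n}).Nonempty ↔
      ∃ᶠ s in atTop, s.unpair.1 = e ∧ p s = true := by
  rw [abs_le] at hT
  have hw : (0 : ℝ) < (1 / 8) ^ (e + 1) := by positivity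
  constructor
  · rintro ⟨y, hy, hyx⟩
    refine tendsto_sqrt_atTop.frequently ?_
    refine ((hyx.frequently (isOpen_Ioo.mem_nhds hy)).and_eventually
      (tendsto_sqrt_atTop.eventually_ge_atTop (e + 2))).mono ?_
    rintro n ⟨hn, hs⟩
    exact eq_of_octal_sub_mem hs ⟨by linarith [hn.1, hT.1], by linarith [hn.2, hT.2]⟩
  · intro h
    have hsq : Tendsto (fun s : ℕ => s * s) atTop atTop := tendsto_id.atTop_mul_atTop₀ tendsto_id
    have hfr : ∃ᶠ n in atTop, τ + octal p n ∈ Icc (1 / 4 + 1 / 4 * (1 / 8) ^ (e + 1) + τ)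
        (1 / 4 + 2 / 7 * (1 / 8) ^ (e + 1) + τ) := by
      refine hsq.frequently ((h.and_eventually (eventually_gt_atTop 0)).mono ?_)
      rintro s ⟨⟨he, hp⟩, hs⟩
      have := octal_sq he hs hp
      constructor <;> linarith [this.1, this.2]
    obtain ⟨y, hy, hyx⟩ := isCompact_Icc.exists_mapClusterPt_of_frequently hfr
    exact ⟨y, ⟨by linarith [hy.1, hT.1], by linarith [hy.2, hT.2]⟩, hyx⟩

lemma totSet_manyOneReducible :
    (fun e : ℕ => e ∈ TotSet) ≤₀ fun p : ℚ × ℚ => p.1 < p.2 ∧ (Ioo (p.1 : ℝ) (p.2 : ℝ) ∩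
      {y | MapClusterPt y atTop fun n => offset + octal haltsAt n}).Nonempty := by
  have hw : Computable fun e : ℕ => (1 : ℚ) / (8 : ℕ) ^ (e + 1) :=
    computable_inv_pow 8 (by norm_num) Computable.succ
  have hT : Computable fun e : ℕ => offsetApprox (3 * e + 8) :=
    computable_offsetApprox.comp (Primrec.nat_add.comp
      (Primrec.nat_mul.comp (Primrec.const 3) Primrec.id) (Primrec.const 8)).to_comp
  have hend : ∀ a : ℚ, Computable fun e : ℕ =>
      1 / 4 + a * ((1 : ℚ) / (8 : ℕ) ^ (e + 1)) + offsetApprox (3 * e + 8) := fun a =>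
    computable_add (computable_add (Computable.const (1 / 4))
      (computable_mul (Computable.const a) hw)) hT
  refine ⟨_, (hend (3 / 16)).pair (hend (3 / 8)), fun e => ?_⟩
  have herr := abs_offset_sub_le (3 * e + 8)
  have hpow : (1 : ℝ) / 2 ^ (3 * e + 8) = 1 / 32 * (1 / 8) ^ (e + 1) := by
    rw [one_div_pow, show (8 : ℝ) = 2 ^ 3 by norm_num, ← pow_mul,
      show 3 * e + 8 = 3 * (e + 1) + 5 by ring, pow_add]
    field_simp
    norm_num
  rw [hpow] at herr
  have hlt : 1 / 4 + (3 / 16) * ((1 : ℚ) / (8 : ℕ) ^ (e + 1)) + offsetApprox (3 * e + 8) <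
      1 / 4 + (3 / 8) * ((1 : ℚ) / (8 : ℕ) ^ (e + 1)) + offsetApprox (3 * e + 8) := by
    have : (0 : ℚ) < (1 : ℚ) / (8 : ℕ) ^ (e + 1) := by positivity
    linarith
  beta_reduce
  rw [← frequently_haltsAt_iff, ← inter_nonempty_iff_frequently herr]
  simp only [hlt, true_and]
  push_cast
  simp only [one_div_pow]

end ZigzagAttractor

/-- A computable interval map with a metric attractor (w.r.t. Lebesgue measure) whose inner
collection is Π₂ and Π₂-complete (`Tot` many-one reduces to it). -/
theorem stmt19 :
    ∃ (f : ℝ → ℝ) (A : Set ℝ),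
      ComputableRealMap f ∧ Set.MapsTo f (Set.Icc 0 1) (Set.Icc 0 1) ∧
      IsClosed A ∧ Set.MapsTo f A A ∧
      IsMetricAttractor f (volume.restrict (Set.Icc (0:ℝ) 1)) A ∧
      PiTwo {p : ℚ × ℚ | p.1 < p.2 ∧ (Set.Ioo (p.1 : ℝ) (p.2 : ℝ) ∩ A).Nonempty} ∧
      ((fun e : ℕ => e ∈ TotSet) ≤₀
        fun p : ℚ × ℚ => p.1 < p.2 ∧ (Set.Ioo (p.1 : ℝ) (p.2 : ℝ) ∩ A).Nonempty) := by
  obtain ⟨p, hp, hred⟩ : ∃ p : ℕ → Bool, Computable p ∧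
      ((fun e : ℕ => e ∈ TotSet) ≤₀ fun I : ℚ × ℚ => I.1 < I.2 ∧ (Ioo (I.1 : ℝ) (I.2 : ℝ) ∩
        {y | MapClusterPt y atTop fun n =>
          ZigzagAttractor.offset + ZigzagAttractor.octal p n}).Nonempty) :=
    ⟨_, ZigzagAttractor.computable_haltsAt, ZigzagAttractor.totSet_manyOneReducible⟩
  let τ := ZigzagAttractor.offset
  let z := ZigzagAttractor.octal p
  have hτ0 : 0 ≤ τ := ZigzagAttractor.offset_nonneg
  have hτ1 : τ ≤ 1 / 7 := ZigzagAttractor.offset_le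
  have hz0 : 0 ≤ z 0 := ZigzagAttractor.octal_nonneg 0
  have hz1 : z 0 ≤ 2 / 7 := ZigzagAttractor.octal_le 0
  have ht : 7 * τ ≤ 1 := by linarith
  have hc0 : 0 ≤ τ + z 0 := by linarith
  have hc1 : τ + z 0 ≤ 1 := by linarith
  have hcont := ZigzagAttractor.continuous_zigzagMap (7 * τ) (τ + z 0)
  have horbit := ZigzagAttractor.computable_orbitApprox hp
  have hdiag := horbit.comp (Computable.id.pair Computable.id)
  have hzero := horbit.comp ((Computable.const 0).pair Computable.id)
  have hω : omegaSet (ZigzagAttractor.zigzagMap (7 * τ) (τ + z 0)) (τ + z 0) =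
      {y | MapClusterPt y atTop fun n => τ + z n} := by
    have : (fun n => (ZigzagAttractor.zigzagMap (7 * τ) (τ + z 0))^[n] (τ + z 0)) =
        fun n => τ + z n :=
      funext (ZigzagAttractor.iterate_zigzagMap_add_octal hτ0 hτ1 _)
    rw [omegaSet, this]
  have : IsProbabilityMeasure (volume.restrict (Icc (0 : ℝ) 1)) :=
    ⟨by rw [Measure.restrict_apply_univ, Real.volume_Icc]; simp⟩
  have hattr := ZigzagAttractor.isMetricAttractor_omegaSet hcont (volume.restrict (Icc (0 : ℝ) 1))
    (τ + z 0) (ZigzagAttractor.ae_exists_iterate_zigzagMap_eq hc0 hc1 ht)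
  refine ⟨ZigzagAttractor.zigzagMap (7 * τ) (τ + z 0), omegaSet _ (τ + z 0), ?_,
    ZigzagAttractor.mapsTo_zigzagMap hc0 hc1 ht, hattr.1, hattr.2.1, hattr, ?_, ?_⟩
  · refine ZigzagAttractor.computableRealMap_zigzagMap
      (T := fun k => 7 * ZigzagAttractor.offsetApprox (k + 3))
      (C := ZigzagAttractor.orbitApprox p 0)
      (RatComputability.computable_mul (Computable.const 7)
        (ZigzagAttractor.computable_offsetApprox.comp
          (Primrec.nat_add.comp Primrec.id (Primrec.const 3)).to_comp))
      hzero (fun k => ?_)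
      (ZigzagAttractor.abs_orbit_sub_le 0)
    have h := ZigzagAttractor.abs_offset_sub_le (k + 3)
    have hpos : (0 : ℝ) < 1 / 2 ^ k := by positivity
    rw [pow_add, ← div_div] at h
    push_cast
    rw [← mul_sub, abs_mul, abs_of_pos (by norm_num : (0 : ℝ) < 7)]
    change |τ - _| ≤ _ at h
    linarith
  · rw [hω]
    refine ZigzagAttractor.piTwo_mapClusterPt (X := fun n =>
      ZigzagAttractor.orbitApprox p n n) hdiag (fun n => ZigzagAttractor.abs_orbit_sub_le n n) fun y hy => ?_
    have hy' : MapClusterPt (-τ + y) atTop ((fun x => -τ + x) ∘ fun n => τ + z n) :=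
      hy.continuousAt_comp (continuous_const.add continuous_id).continuousAt
    have hcomp : ((fun x => -τ + x) ∘ fun n => τ + z n) = z :=
      funext fun n => neg_add_cancel_left τ (z n)
    rw [hcomp] at hy'
    obtain ⟨q, hq⟩ := ZigzagAttractor.mem_range_ratCast_of_mapClusterPt hy'
    rw [show y = τ + q by rw [hq]; ring]
    exact ZigzagAttractor.irrational_offset.add_ratCast q
  · rw [hω]
    exact hred
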